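/- arXiv:1506.02435 — 2 statements merged into one kernel-verified Lean document; each statement's English description precedes it below -/
import Mathlib

section
/- Let Γ be an n-vertex connected nonregular finite simple graph whose adjacency matrix has exactly three distinct eigenvalues s > 1 > −t with t ≥ 2, let m be the multiplicity of the eigenvalue −t, and let x and y be adjacent vertices with ν_{x,y} common neighbours. Then d_x + d_y − ν_{x,y} ≥ n − 2m. Moreover, if d_x = Δ(Γ) and α_x := √(d_x − t), then n ≤ ((t+1)(α_x² − α_x + 3t) + 2α_x² + 2t − 2)/(t − 1) and (√(2n) − (t+1))² > (t−1)(t−2) − 2α_x². -/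
section

open Matrix

lemma Matrix.exists_eq_mul_fin_rank {ι κ : Type*} [Fintype κ] [Finite ι] (X : Matrix ι κ ℝ) :
    ∃ (P : Matrix ι (Fin X.rank) ℝ) (Q : Matrix (Fin X.rank) κ ℝ), X = P * Q := by
  have : Fintype ι := Fintype.ofFinite ι
  let b : Module.Basis (Fin X.rank) ℝ (Submodule.span ℝ (Set.range X.col)) :=
    Module.finBasisOfFinrankEq ℝ _ X.rank_eq_finrank_span_cols.symm
  let c (j : κ) : Submodule.span ℝ (Set.range X.col) :=
    ⟨X.col j, Submodule.subset_span ⟨j, rfl⟩⟩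
  refine ⟨of fun i k => (b k : ι → ℝ) i, of fun k j => b.repr (c j) k, ?_⟩
  ext i j
  have h := congrArg (fun z : Submodule.span ℝ (Set.range X.col) => (z : ι → ℝ) i)
    (b.sum_repr (c j))
  simp only [Submodule.coe_sum, Finset.sum_apply, Submodule.coe_smul, Pi.smul_apply,
    smul_eq_mul] at h
  rw [mul_apply]
  simp only [of_apply]
  rw [show X i j = (c j : ι → ℝ) i from rfl, ← h]
  exact Finset.sum_congr rfl fun k _ => mul_comm _ _

lemma Matrix.rank_hadamard_self_le {ι κ : Type*} [Fintype κ] [Finite ι] (X : Matrix ι κ ℝ) :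
    (X ⊙ X).rank ≤ (X.rank + 1).choose 2 := by
  obtain ⟨P, Q, h⟩ := X.exists_eq_mul_fin_rank
  let P₂ : Matrix ι (Sym2 (Fin X.rank)) ℝ := of fun i z =>
    Sym2.lift ⟨fun a b => P i a * P i b, fun a b => mul_comm _ _⟩ z
  let Q₂ : Matrix (Sym2 (Fin X.rank)) κ ℝ := of fun z j =>
    ∑ p : Fin X.rank × Fin X.rank with s(p.1, p.2) = z, Q p.1 j * Q p.2 j
  have hX : X ⊙ X = P₂ * Q₂ := by
    ext i j
    have hij : X i j = ∑ k, P i k * Q k j := by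
      conv_lhs => rw [h]
      rw [mul_apply]
    rw [hadamard_apply, hij, Finset.sum_mul_sum, ← Fintype.sum_prod_type', mul_apply,
      ← Finset.sum_fiberwise Finset.univ
        (fun p : Fin X.rank × Fin X.rank => s(p.1, p.2))]
    refine Finset.sum_congr rfl fun z _ => ?_
    simp only [P₂, Q₂, of_apply, Finset.mul_sum]
    refine Finset.sum_congr rfl fun p hp => ?_
    rw [← (Finset.mem_filter.1 hp).2, Sym2.lift_mk]
    ring
  rw [hX]
  calc (P₂ * Q₂).rank ≤ P₂.rank := rank_mul_le_left _ _
    _ ≤ Fintype.card (Sym2 (Fin X.rank)) := rank_le_card_width _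
    _ = _ := by rw [Sym2.card, Fintype.card_fin]

lemma Matrix.rank_eq_trace_of_isIdempotentElem {ι : Type*} [Fintype ι] [DecidableEq ι]
    {E : Matrix ι ι ℝ} (hE : IsIdempotentElem E) : (E.rank : ℝ) = E.trace := by
  have h : IsIdempotentElem (toLin' E) := by
    rw [IsIdempotentElem, Module.End.mul_eq_comp, ← toLin'_mul, hE.eq]
  have := (LinearMap.IsIdempotentElem.isProj_range _ h).trace
  rw [trace_toLin'_eq] at this
  rw [this]
  rfl

lemma Matrix.IsHermitian.prod_sub_eq_zero {ι : Type*} [Fintype ι] [DecidableEq ι]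
    {A : Matrix ι ι ℝ} (hA : A.IsHermitian) {a b c : ℝ} (h : spectrum ℝ A ⊆ {a, b, c}) :
    (A - a • 1) * (A - b • 1) * (A - c • 1) = 0 := by
  have key : cfc (fun x : ℝ => (x - a) * (x - b) * (x - c)) A = 0 := by
    rw [cfc_congr (g := fun _ => 0), cfc_const_zero]
    intro x hx
    rcases h hx with rfl | rfl | rfl <;> simp
  have hA' : IsSelfAdjoint A := hA
  rw [cfc_mul _ _ A, cfc_mul _ _ A, cfc_sub _ _ A, cfc_sub _ _ A, cfc_sub _ _ A, cfc_id' ℝ A,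
    cfc_const _ A, cfc_const _ A, cfc_const _ A] at key
  simpa [Algebra.algebraMap_eq_smul_one] using key

lemma Matrix.IsHermitian.posSemidef_smul_one_sub {ι : Type*} [Fintype ι] [DecidableEq ι]
    {A : Matrix ι ι ℝ} (hA : A.IsHermitian) {s : ℝ} (h : ∀ x ∈ spectrum ℝ A, x ≤ s) :
    (s • (1 : Matrix ι ι ℝ) - A).PosSemidef := by
  have hB : (s • (1 : Matrix ι ι ℝ) - A).IsHermitian := by
    refine IsHermitian.sub ?_ hA
    simp [IsHermitian]
  rw [hB.posSemidef_iff_eigenvalues_nonneg]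
  intro i
  have := hB.eigenvalues_mem_spectrum_real i
  generalize hB.eigenvalues i = z at this ⊢
  rw [← Algebra.algebraMap_eq_smul_one, ← spectrum.singleton_sub_eq] at this
  obtain ⟨_, rfl, y, hy, h'⟩ := this
  have := h y hy
  simp only [Pi.zero_apply]
  linarith [h']

lemma Matrix.exists_mulVec_eq_smul_of_mem_spectrum {ι : Type*} [Fintype ι] [DecidableEq ι]
    {A : Matrix ι ι ℝ} {s : ℝ} (h : s ∈ spectrum ℝ A) : ∃ v ≠ 0, A *ᵥ v = s • v := by
  rw [spectrum.mem_iff, isUnit_iff_isUnit_det, isUnit_iff_ne_zero, not_not] at h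
  obtain ⟨v, hv, h⟩ := exists_mulVec_eq_zero_iff.2 h
  refine ⟨v, hv, ?_⟩
  rw [sub_mulVec, Algebra.algebraMap_eq_smul_one, smul_mulVec, one_mulVec, sub_eq_zero] at h
  exact h.symm

lemma Matrix.PosSemidef.quadForm_five_nonneg {n : Type*} {M : Matrix n n ℝ}
    (hM : M.PosSemidef) (p q r u v : n) (a b c d e : ℝ) :
    0 ≤ a * (M p p * a + M p q * b + M p r * c + M p u * d + M p v * e)
      + b * (M q p * a + M q q * b + M q r * c + M q u * d + M q v * e)
      + c * (M r p * a + M r q * b + M r r * c + M r u * d + M r v * e)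
      + d * (M u p * a + M u q * b + M u r * c + M u u * d + M u v * e)
      + e * (M v p * a + M v q * b + M v r * c + M v u * d + M v v * e) := by
  have key := (hM.submatrix ![p, q, r, u, v]).dotProduct_mulVec_nonneg ![a, b, c, d, e]
  simpa [dotProduct, mulVec, Fin.sum_univ_five] using key

namespace SimpleGraph

lemma Connected.eq_zero_of_adjMatrix_mulVec_eq_smul {V : Type*} [Fintype V]
    {Γ : SimpleGraph V} [DecidableRel Γ.Adj] (hc : Γ.Connected) {w : V → ℝ} {s : ℝ}
    (hw0 : ∀ v, 0 ≤ w v) (hw : Γ.adjMatrix ℝ *ᵥ w = s • w) {x : V} (hx : w x = 0) : w = 0 := by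
  have step : ∀ u v, Γ.Adj u v → w u = 0 → w v = 0 := by
    intro u v huv hu
    have h := congrFun hw u
    rw [adjMatrix_mulVec_apply, Pi.smul_apply, hu, smul_zero,
      Finset.sum_eq_zero_iff_of_nonneg fun i _ => hw0 i] at h
    exact h v (by simpa using huv)
  ext v
  obtain ⟨p⟩ := hc.preconnected x v
  induction p with
  | nil => exact hx
  | cons h _ ih => exact ih (step _ _ h hx)

variable {V : Type*} [Fintype V] [DecidableEq V] {Γ : SimpleGraph V} [DecidableRel Γ.Adj]

lemma adjMatrix_mulVec_abs {s : ℝ} (hs : ∀ z ∈ spectrum ℝ (Γ.adjMatrix ℝ), z ≤ s)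
    {w : V → ℝ} (hw : Γ.adjMatrix ℝ *ᵥ w = s • w) :
    Γ.adjMatrix ℝ *ᵥ |w| = s • |w| := by
  have hP := (Γ.isHermitian_adjMatrix ℝ).posSemidef_smul_one_sub hs
  suffices h : (s • (1 : Matrix V V ℝ) - Γ.adjMatrix ℝ) *ᵥ |w| = 0 by
    rw [sub_mulVec, smul_mulVec, one_mulVec, sub_eq_zero] at h
    exact h.symm
  rw [← hP.dotProduct_mulVec_zero_iff, star_trivial]
  refine le_antisymm ?_ (by simpa using hP.dotProduct_mulVec_nonneg |w|)
  have h0 : w ⬝ᵥ ((s • (1 : Matrix V V ℝ) - Γ.adjMatrix ℝ) *ᵥ w) = 0 := by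
    rw [sub_mulVec, smul_mulVec, one_mulVec, hw, sub_self, dotProduct_zero]
  rw [← h0, sub_mulVec, sub_mulVec, smul_mulVec, smul_mulVec, one_mulVec, one_mulVec,
    dotProduct_sub, dotProduct_sub, dotProduct_smul, dotProduct_smul]
  have h1 : |w| ⬝ᵥ |w| = w ⬝ᵥ w := by
    simp [dotProduct]
  have h2 : w ⬝ᵥ (Γ.adjMatrix ℝ *ᵥ w) ≤ |w| ⬝ᵥ (Γ.adjMatrix ℝ *ᵥ |w|) := by
    simp only [dotProduct, adjMatrix_mulVec_apply, Finset.mul_sum]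
    refine Finset.sum_le_sum fun i _ => Finset.sum_le_sum fun j _ => ?_
    rw [Pi.abs_apply, Pi.abs_apply, ← abs_mul]
    exact le_abs_self _
  rw [h1]
  linarith

lemma Connected.exists_pos_adjMatrix_mulVec (hc : Γ.Connected) {s : ℝ}
    (hmem : s ∈ spectrum ℝ (Γ.adjMatrix ℝ)) (hs : ∀ z ∈ spectrum ℝ (Γ.adjMatrix ℝ), z ≤ s) :
    ∃ u : V → ℝ, (∀ v, 0 < u v) ∧ Γ.adjMatrix ℝ *ᵥ u = s • u ∧
      ∀ w : V → ℝ, Γ.adjMatrix ℝ *ᵥ w = s • w → ∃ c : ℝ, w = c • u := by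
  obtain ⟨w, hw0, hw⟩ := exists_mulVec_eq_smul_of_mem_spectrum hmem
  have hu := adjMatrix_mulVec_abs hs hw
  have hpos : ∀ v, 0 < |w| v := by
    intro v
    refine lt_of_le_of_ne (abs_nonneg _) fun h => hw0 ?_
    have := hc.eq_zero_of_adjMatrix_mulVec_eq_smul (fun v => abs_nonneg _) hu h.symm
    exact funext fun v => abs_eq_zero.1 (congrFun this v)
  refine ⟨|w|, hpos, hu, fun z hz => ?_⟩
  obtain ⟨x⟩ := hc.nonempty
  refine ⟨z x / |w| x, ?_⟩
  rw [← sub_eq_zero]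
  suffices h : |z - (z x / |w| x) • (|w| : V → ℝ)| = 0 from
    funext fun v => abs_eq_zero.1 (congrFun h v)
  refine hc.eq_zero_of_adjMatrix_mulVec_eq_smul (x := x) (fun v => abs_nonneg _)
    (adjMatrix_mulVec_abs hs (s := s) ?_) ?_
  · rw [mulVec_sub, mulVec_smul, hz, hu, smul_sub, smul_comm]
  · have := (hpos x).ne'
    simp only [Pi.abs_apply, Pi.sub_apply, Pi.smul_apply, smul_eq_mul] at this ⊢
    field_simp
    simp

lemma Connected.exists_vecMulVec_eq (hc : Γ.Connected) {s t : ℝ} (hs : 1 < s) (hst : 0 < s + t)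
    (hspec : spectrum ℝ (Γ.adjMatrix ℝ) = {s, 1, -t}) (ht : -t < 1) :
    ∃ α : V → ℝ, (∀ v, 0 < α v) ∧ Γ.adjMatrix ℝ *ᵥ α = s • α ∧
      (Γ.adjMatrix ℝ - 1) * (Γ.adjMatrix ℝ + t • 1) = vecMulVec α α := by
  set A := Γ.adjMatrix ℝ with hA
  have hle : ∀ z ∈ spectrum ℝ A, z ≤ s := by
    rw [hspec]
    rintro z (rfl | rfl | rfl) <;> linarith
  obtain ⟨u, hu0, hu, huniq⟩ := hc.exists_pos_adjMatrix_mulVec (s := s) (by simp [← hA, hspec]) hle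
  set M := (A - 1) * (A + t • 1) with hM
  have hcubic : A * M = s • M := by
    have := (Γ.isHermitian_adjMatrix ℝ).prod_sub_eq_zero hspec.subset
    rw [← hA, one_smul, neg_smul, sub_neg_eq_add, mul_assoc, ← hM, sub_mul, sub_eq_zero,
      smul_mul_assoc, one_mul] at this
    exact this
  have hMt : Mᵀ = M := by
    rw [hM, transpose_mul, transpose_add, transpose_sub, transpose_smul, transpose_one, hA,
      transpose_adjMatrix]
    simp only [sub_mul, mul_sub, mul_add, add_mul, mul_smul_comm, smul_mul_assoc, mul_one, one_mul]
    module
  have hcol : ∀ j, ∃ c : ℝ, M.col j = c • u := fun j => huniq _ <| by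
    ext i
    exact congrFun (congrFun hcubic i) j
  choose c hc' using hcol
  have hMij : ∀ i j, M i j = c j * u i := fun i j => congrFun (hc' j) i
  have hsymm : ∀ i j, c j * u i = c i * u j := fun i j => by
    rw [← hMij, ← hMij, ← transpose_apply M, hMt]
  obtain ⟨x⟩ := hc.nonempty
  set κ := c x / u x with hκ
  have hcκ : ∀ j, c j = κ * u j := fun j => by
    have := hsymm x j
    have := (hu0 x).ne'
    rw [hκ]
    field_simp
    linarith
  have hMu : M *ᵥ u = ((s - 1) * (s + t)) • u := by
    rw [hM, ← mulVec_mulVec, add_mulVec, smul_mulVec, one_mulVec, hu, ← add_smul, mulVec_smul,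
      sub_mulVec, one_mulVec, hu]
    ext i
    simp only [Pi.smul_apply, Pi.sub_apply, smul_eq_mul]
    ring
  have hκ0 : 0 < κ := by
    have h := congrFun hMu x
    have h' : κ * ((∑ j, u j ^ 2) * u x) = (s - 1) * (s + t) * u x := by
      rw [← show _ = (s - 1) * (s + t) * u x from h, mulVec, dotProduct, Finset.sum_mul,
        Finset.mul_sum]
      refine Finset.sum_congr rfl fun j _ => ?_
      rw [hMij, hcκ]
      ring
    have h1 : 0 < (s - 1) * (s + t) * u x := mul_pos (mul_pos (by linarith) hst) (hu0 x)
    have h2 : 0 ≤ (∑ j, u j ^ 2) * u x :=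
      mul_nonneg (Finset.sum_nonneg fun _ _ => sq_nonneg _) (hu0 x).le
    rw [← h'] at h1
    exact pos_of_mul_pos_left h1 h2
  refine ⟨√κ • u, fun v => mul_pos (Real.sqrt_pos.2 hκ0) (hu0 v), ?_, ?_⟩
  · rw [mulVec_smul, hu, smul_comm]
  · ext i j
    rw [hMij, hcκ, vecMulVec_apply, Pi.smul_apply, Pi.smul_apply, smul_eq_mul, smul_eq_mul]
    have := Real.mul_self_sqrt hκ0.le
    linear_combination (-u i * u j) * this

/-- Data attached to a connected graph with adjacency spectrum `{s, 1, -t}`: a positive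
eigenvector `α` for `s`, normalised so that `(A - 1) (A + t) = α αᵀ`. -/
structure ThreeEigenvalues (Γ : SimpleGraph V) [DecidableRel Γ.Adj] (s t : ℝ) (α : V → ℝ) :
    Prop where
  connected : Γ.Connected
  one_lt : 1 < s
  two_le : 2 ≤ t
  spectrum_eq : spectrum ℝ (Γ.adjMatrix ℝ) = {s, 1, -t}
  pos : ∀ v, 0 < α v
  mulVec_eq : Γ.adjMatrix ℝ *ᵥ α = s • α
  mul_eq : (Γ.adjMatrix ℝ - 1) * (Γ.adjMatrix ℝ + t • 1) = vecMulVec α α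

namespace ThreeEigenvalues

variable {s t : ℝ} {α : V → ℝ}

lemma mul_apply_eq (h : Γ.ThreeEigenvalues s t α) (u v : V) :
    α u * α v = Fintype.card (Γ.commonNeighbors u v) + (t - 1) * Γ.adjMatrix ℝ u v
      - t * (1 : Matrix V V ℝ) u v := by
  have hsq : (Γ.adjMatrix ℝ * Γ.adjMatrix ℝ) u v = Fintype.card (Γ.commonNeighbors u v) := by
    rw [adjMatrix_mul_apply]
    simp only [adjMatrix_apply, Finset.sum_boole]
    rw [← Set.toFinset_card]
    congr 2
    ext w
    simp [mem_commonNeighbors, adj_comm]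
  rw [← vecMulVec_apply, ← h.mul_eq, ← hsq]
  have : (Γ.adjMatrix ℝ - 1) * (Γ.adjMatrix ℝ + t • 1) = Γ.adjMatrix ℝ * Γ.adjMatrix ℝ
      + (t - 1) • Γ.adjMatrix ℝ - t • 1 := by
    simp only [sub_mul, mul_add, mul_smul_comm, mul_one, one_mul]
    module
  rw [this]
  simp

lemma sq_eq (h : Γ.ThreeEigenvalues s t α) (v : V) : α v ^ 2 = Γ.degree v - t := by
  rw [sq, h.mul_apply_eq, ← SimpleGraph.card_neighborSet_eq_degree]
  simp [commonNeighbors]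

lemma adj_mul_eq (h : Γ.ThreeEigenvalues s t α) {u v : V} (huv : Γ.Adj u v) :
    α u * α v = Fintype.card (Γ.commonNeighbors u v) + t - 1 := by
  rw [h.mul_apply_eq, adjMatrix_apply, if_pos huv, one_apply_ne huv.ne]
  ring

lemma sum_sq (h : Γ.ThreeEigenvalues s t α) : ∑ v, α v ^ 2 = (s - 1) * (s + t) := by
  obtain ⟨x⟩ := h.connected.nonempty
  have h1 : vecMulVec α α *ᵥ α = ((s - 1) * (s + t)) • α := by
    rw [← h.mul_eq, ← mulVec_mulVec, add_mulVec, smul_mulVec, one_mulVec, h.mulVec_eq, ← add_smul,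
      mulVec_smul, sub_mulVec, one_mulVec, h.mulVec_eq]
    ext i
    simp only [Pi.smul_apply, Pi.sub_apply, smul_eq_mul]
    ring
  have h2 := congrFun h1 x
  simp only [mulVec, dotProduct, vecMulVec_apply, Pi.smul_apply, smul_eq_mul] at h2
  refine mul_left_cancel₀ (h.pos x).ne' ?_
  rw [Finset.mul_sum, mul_comm _ (_ * _), ← h2]
  exact Finset.sum_congr rfl fun _ _ => by ring

lemma rank_sub_one (h : Γ.ThreeEigenvalues s t α) {m : ℕ}
    (hm : (m : ℝ) * (t + 1) = s + (Fintype.card V : ℝ) - 1) :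
    (Γ.adjMatrix ℝ - 1).rank ≤ m + 1 := by
  have hs := h.one_lt
  have ht := h.two_le
  set A := Γ.adjMatrix ℝ with hA
  set c := (s - 1) * (t + 1) with hc
  have hc0 : c ≠ 0 := (mul_pos (by linarith) (by linarith)).ne'
  set F := (A - s • 1) * (A + t • 1) with hF
  have hcubic : (A - 1) * F = 0 := by
    have hspec : spectrum ℝ A ⊆ {1, s, -t} := by
      rw [h.spectrum_eq, Set.insert_comm]
    have := (Γ.isHermitian_adjMatrix ℝ).prod_sub_eq_zero hspec
    rwa [← hA, one_smul, neg_smul, sub_neg_eq_add, mul_assoc, ← hF] at this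
  have hF' : F = (A - 1) * (A + (t + 1 - s) • 1) - c • 1 := by
    rw [hF, hc]
    simp only [sub_mul, mul_add, mul_smul_comm, smul_mul_assoc, mul_one, one_mul]
    module
  have hFF : F * F = -c • F := by
    nth_rw 1 [hF']
    have hcomm : (A - 1) * (A + (t + 1 - s) • 1) = (A + (t + 1 - s) • 1) * (A - 1) := by
      simp only [sub_mul, mul_add, mul_smul_comm, smul_mul_assoc, mul_one, one_mul, add_mul,
        mul_sub]
      module
    rw [hcomm, sub_mul, mul_assoc, hcubic, mul_zero, zero_sub, smul_mul_assoc, one_mul, neg_smul]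
  set E : Matrix V V ℝ := 1 + c⁻¹ • F with hE
  have hEi : IsIdempotentElem E := by
    rw [IsIdempotentElem, hE]
    simp only [add_mul, mul_add, mul_one, one_mul, smul_mul_assoc, mul_smul_comm, hFF, smul_smul]
    match_scalars
    · simp
    · field_simp
      ring
  have hAE : (A - 1) = (A - 1) * E := by
    rw [hE, mul_add, mul_smul_comm, hcubic, smul_zero, add_zero, mul_one]
  have htr : E.trace = m + 1 := by
    have hFM : F = vecMulVec α α + (1 - s) • (A + t • 1) := by
      rw [← h.mul_eq, hF]
      simp only [sub_mul, mul_add, mul_smul_comm, smul_mul_assoc, mul_one, one_mul]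
      module
    have : (vecMulVec α α).trace = (s - 1) * (s + t) := by
      rw [← h.sum_sq]
      simp [trace, vecMulVec_apply, sq]
    rw [hE, hFM]
    simp only [trace_add, trace_smul, this, trace_one, hA, trace_adjMatrix, smul_eq_mul]
    rw [← sub_eq_zero, ← mul_right_inj' hc0]
    have e : c * c⁻¹ = 1 := mul_inv_cancel₀ hc0
    rw [hc] at e ⊢
    linear_combination ((s - 1) * (s + t) + (1 - s) * (0 + t * (Fintype.card V : ℝ))) * e
      - (s - 1) * hm
  have hr := rank_eq_trace_of_isIdempotentElem hEi
  rw [htr] at hr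
  rw [hAE]
  exact (rank_mul_le_right _ _).trans (by exact_mod_cast hr.le)

lemma card_le_choose (h : Γ.ThreeEigenvalues s t α) {m : ℕ}
    (hm : (m : ℝ) * (t + 1) = s + (Fintype.card V : ℝ) - 1) :
    Fintype.card V ≤ (m + 2).choose 2 := by
  have hs := h.one_lt
  have ht := h.two_le
  set A := Γ.adjMatrix ℝ with hA
  have hHad : (A - 1) ⊙ (A - 1) = A + 1 := by
    ext i j
    rcases eq_or_ne i j with rfl | hij
    · simp [hA]
    · simp [hA, adjMatrix_apply, one_apply_ne hij]
  have hunit : IsUnit (A + 1) := by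
    have h1 : (-1 : ℝ) ∉ spectrum ℝ A := by
      rw [h.spectrum_eq]
      simp only [Set.mem_insert_iff, Set.mem_singleton_iff]
      rintro (h | h | h) <;> linarith
    rw [spectrum.notMem_iff, Algebra.algebraMap_eq_smul_one, neg_one_smul] at h1
    rw [show A + 1 = -(-1 - A) by abel]
    exact h1.neg
  rw [← rank_of_isUnit _ hunit, ← hHad]
  exact (rank_hadamard_self_le _).trans
    (Nat.choose_le_choose 2 (Nat.succ_le_succ (h.rank_sub_one hm)))

lemma card_le_of_isIndepSet (h : Γ.ThreeEigenvalues s t α) {m : ℕ}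
    (hm : (m : ℝ) * (t + 1) = s + (Fintype.card V : ℝ) - 1) {T : Finset V}
    (hT : Γ.IsIndepSet (T : Set V)) : T.card ≤ m + 1 := by
  refine le_trans ?_ (h.rank_sub_one hm)
  have hsub : (Γ.adjMatrix ℝ - 1).submatrix (Subtype.val : T → V) (Subtype.val : T → V)
      = -1 := by
    ext i j
    rcases eq_or_ne i j with rfl | hij
    · simp
    · have hij' : (i : V) ≠ j := fun e => hij (Subtype.ext e)
      have := hT i.2 j.2 hij'
      simp [adjMatrix_apply, this, one_apply_ne hij, one_apply_ne hij']
  calc T.card = Fintype.card T := (Fintype.card_coe T).symm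
    _ = (-1 : Matrix T T ℝ).rank := (rank_of_isUnit (-1 : Matrix T T ℝ) (IsUnit.neg isUnit_one)).symm
    _ ≤ _ := by rw [← hsub]; exact rank_submatrix_le _ _ _

lemma posSemidef (h : Γ.ThreeEigenvalues s t α) :
    (vecMulVec α α - (s + t) • (Γ.adjMatrix ℝ - 1)).PosSemidef := by
  have hs := h.one_lt
  have ht := h.two_le
  set A := Γ.adjMatrix ℝ with hA
  set G := (A - 1) * (A - s • 1) with hG
  have hGα : vecMulVec α α - (s + t) • (A - 1) = G := by
    rw [← h.mul_eq, hG]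
    simp only [sub_mul, mul_sub, mul_add, mul_smul_comm, mul_one, one_mul]
    module
  have hcubic : (A + t • 1) * G = 0 := by
    have hspec : spectrum ℝ A ⊆ {-t, 1, s} := by
      rw [h.spectrum_eq]
      rintro z (rfl | rfl | rfl) <;> simp
    have := (Γ.isHermitian_adjMatrix ℝ).prod_sub_eq_zero hspec
    rwa [← hA, one_smul, neg_smul, sub_neg_eq_add, mul_assoc, ← hG] at this
  set k := (1 + t) * (s + t) with hk
  have hk0 : 0 < k := mul_pos (by linarith) (by linarith)
  have hGk : G = (A - (1 + s + t) • 1) * (A + t • 1) + k • 1 := by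
    rw [hG, hk]
    simp only [sub_mul, mul_sub, mul_add, mul_smul_comm, smul_mul_assoc, mul_one, one_mul]
    module
  have hGG : G * G = k • G := by
    nth_rw 1 [hGk]
    rw [add_mul, mul_assoc, hcubic, mul_zero, zero_add, smul_mul_assoc, one_mul]
  have hGt : Gᴴ = G := by
    rw [hG, conjTranspose_eq_transpose_of_trivial, transpose_mul, transpose_sub, transpose_sub,
      transpose_smul, transpose_one, hA, transpose_adjMatrix]
    simp only [sub_mul, mul_sub, mul_smul_comm, smul_mul_assoc, mul_one, one_mul]
    module
  rw [hGα, show G = k⁻¹ • (Gᴴ * G) by rw [hGt, hGG, smul_smul, inv_mul_cancel₀ hk0.ne', one_smul]]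
  exact (posSemidef_conjTranspose_mul_self G).smul (inv_nonneg.2 hk0.le)

lemma eq_of_adj_of_not_adj (h : Γ.ThreeEigenvalues s t α) {x y a b c : V} (hxy : Γ.Adj x y)
    (hxa : ¬ Γ.Adj x a) (hxb : ¬ Γ.Adj x b) (hxc : ¬ Γ.Adj x c)
    (hya : ¬ Γ.Adj y a) (hyb : ¬ Γ.Adj y b) (hyc : ¬ Γ.Adj y c)
    (hab : Γ.Adj a b) (hac : Γ.Adj a c) : b = c := by
  by_contra hbc
  have hs := h.one_lt
  have ht := h.two_le
  have key := h.posSemidef.quadForm_five_nonneg x y a b c (4 * α a + 3 * α b + 3 * α c)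
    (4 * α a + 3 * α b + 3 * α c) (-4 * (α x + α y)) (-3 * (α x + α y)) (-3 * (α x + α y))
  have nx : ∀ v, ¬ Γ.Adj y v → x ≠ v := fun v hv e => hv (e ▸ hxy.symm)
  have ny : ∀ v, ¬ Γ.Adj x v → y ≠ v := fun v hv e => hv (e ▸ hxy)
  have hA : ∀ u v, Γ.Adj u v → Γ.adjMatrix ℝ u v - (1 : Matrix V V ℝ) u v = 1 := fun u v huv => by
    simp [huv, one_apply_ne huv.ne]
  have hN : ∀ u v, ¬ Γ.Adj u v → u ≠ v → Γ.adjMatrix ℝ u v - (1 : Matrix V V ℝ) u v = 0 :=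
    fun u v huv hne => by simp [huv, one_apply_ne hne]
  have hD : ∀ u, Γ.adjMatrix ℝ u u - (1 : Matrix V V ℝ) u u = -1 := fun u => by simp
  have hB : 0 ≤ Γ.adjMatrix ℝ b c - (1 : Matrix V V ℝ) b c := by
    rw [one_apply_ne hbc, adjMatrix_apply]
    split_ifs <;> norm_num
  have hBs : Γ.adjMatrix ℝ c b - (1 : Matrix V V ℝ) c b =
      Γ.adjMatrix ℝ b c - (1 : Matrix V V ℝ) b c := by
    rw [one_apply_ne hbc, one_apply_ne (Ne.symm hbc), (Γ.isSymm_adjMatrix (α := ℝ)).apply]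
  have hM : ∀ u v, (vecMulVec α α - (s + t) • (Γ.adjMatrix ℝ - 1)) u v
      = α u * α v - (s + t) * (Γ.adjMatrix ℝ u v - (1 : Matrix V V ℝ) u v) := fun _ _ => rfl
  simp only [hM, hD, hBs, hA x y hxy, hA y x hxy.symm, hA a b hab, hA b a hab.symm,
    hA a c hac, hA c a hac.symm, hN x a hxa (nx a hya), hN x b hxb (nx b hyb),
    hN x c hxc (nx c hyc), hN y a hya (ny a hxa), hN y b hyb (ny b hxb), hN y c hyc (ny c hxc),
    hN a x (fun e => hxa e.symm) (nx a hya).symm, hN b x (fun e => hxb e.symm) (nx b hyb).symm,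
    hN c x (fun e => hxc e.symm) (nx c hyc).symm, hN a y (fun e => hya e.symm) (ny a hxa).symm,
    hN b y (fun e => hyb e.symm) (ny b hxb).symm, hN c y (fun e => hyc e.symm) (ny c hxc).symm]
    at key
  generalize Γ.adjMatrix ℝ b c - (1 : Matrix V V ℝ) b c = β at hB key
  have h1 : 0 < (s + t) * (α x + α y) ^ 2 :=
    mul_pos (by linarith) (pow_pos (add_pos (h.pos x) (h.pos y)) 2)
  have h2 : 0 < ((s + t) * (α x + α y) ^ 2) * (14 + 18 * β) := mul_pos h1 (by linarith)
  linarith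

lemma le_degree_add_degree_sub (h : Γ.ThreeEigenvalues s t α) {m : ℕ}
    (hm : (m : ℝ) * (t + 1) = s + (Fintype.card V : ℝ) - 1) {x y : V} (hxy : Γ.Adj x y) :
    (Fintype.card V : ℝ) - 2 * m
      ≤ Γ.degree x + Γ.degree y - Fintype.card (Γ.commonNeighbors x y) := by
  let S : Finset V := {v | ¬ Γ.Adj x v ∧ ¬ Γ.Adj y v}
  have hS : Fintype.card V + Fintype.card (Γ.commonNeighbors x y)
      = Γ.degree x + Γ.degree y + S.card := by
    have h1 : S = (Γ.neighborFinset x ∪ Γ.neighborFinset y)ᶜ := by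
      ext v
      simp [S]
    have h2 : Fintype.card (Γ.commonNeighbors x y)
        = (Γ.neighborFinset x ∩ Γ.neighborFinset y).card := by
      rw [← Set.toFinset_card]
      congr 1
      ext v
      simp [mem_commonNeighbors]
    have h3 := Finset.card_union_add_card_inter (Γ.neighborFinset x) (Γ.neighborFinset y)
    have h4 := Finset.card_add_card_compl (Γ.neighborFinset x ∪ Γ.neighborFinset y)
    rw [card_neighborFinset_eq_degree, card_neighborFinset_eq_degree] at h3
    rw [h1, h2]
    omega
  classical
  obtain ⟨T, hT, hmax⟩ := Finset.exists_max_image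
    (S.powerset.filter fun T : Finset V => Γ.IsIndepSet (T : Set V)) Finset.card
    ⟨∅, by simp⟩
  rw [Finset.mem_filter, Finset.mem_powerset] at hT
  have hmem : ∀ {v}, v ∈ S → ¬ Γ.Adj x v ∧ ¬ Γ.Adj y v := fun hv => by simpa [S] using hv
  have hxT : x ∉ T := fun hx => (hmem (hT.1 hx)).2 hxy.symm
  have hcardT : T.card ≤ m := by
    have hind : Γ.IsIndepSet ((insert x T : Finset V) : Set V) := by
      rw [Finset.coe_insert]
      refine Set.pairwise_insert.2 ⟨hT.2, fun v hv _ => ?_⟩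
      have := (hmem (hT.1 hv)).1
      exact ⟨this, fun e => this e.symm⟩
    have := h.card_le_of_isIndepSet hm hind
    rw [Finset.card_insert_of_notMem hxT] at this
    omega
  have hcover : S ⊆ T ∪ T.biUnion fun a => {v ∈ S | Γ.Adj a v} := by
    intro v hv
    by_contra hcon
    simp only [Finset.mem_union, Finset.mem_biUnion, Finset.mem_filter, not_or, not_exists,
      not_and] at hcon
    have hind : Γ.IsIndepSet ((insert v T : Finset V) : Set V) := by
      rw [Finset.coe_insert]
      refine Set.pairwise_insert.2 ⟨hT.2, fun a ha _ => ?_⟩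
      exact ⟨fun e => hcon.2 a ha hv e.symm, hcon.2 a ha hv⟩
    have := hmax (insert v T) (by
      rw [Finset.mem_filter, Finset.mem_powerset]
      exact ⟨Finset.insert_subset hv hT.1, hind⟩)
    rw [Finset.card_insert_of_notMem hcon.1] at this
    omega
  have hcardS : S.card ≤ 2 * m := by
    have h1 := Finset.card_le_card hcover
    have h2 := Finset.card_union_le T (T.biUnion fun a => {v ∈ S | Γ.Adj a v})
    have h3 : (T.biUnion fun a => {v ∈ S | Γ.Adj a v}).card ≤ T.card * 1 := by
      refine Finset.card_biUnion_le_card_mul _ _ _ fun a ha => Finset.card_le_one.2 ?_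
      intro b hb c hc
      rw [Finset.mem_filter] at hb hc
      have a' := hmem (hT.1 ha)
      have b' := hmem hb.1
      have c' := hmem hc.1
      exact h.eq_of_adj_of_not_adj hxy a'.1 b'.1 c'.1 a'.2 b'.2 c'.2 hb.2 hc.2
    omega
  have hS' : (Fintype.card V : ℝ) + Fintype.card (Γ.commonNeighbors x y)
      = Γ.degree x + Γ.degree y + S.card := by exact_mod_cast hS
  have : (S.card : ℝ) ≤ 2 * m := by exact_mod_cast hcardS
  linarith

lemma exists_int_eq (h : Γ.ThreeEigenvalues s t α) {x y : V} (hxy : Γ.Adj x y) :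
    ∃ z : ℤ, t = z := by
  have ht := h.two_le
  set ν : ℕ := Fintype.card (Γ.commonNeighbors x y)
  have hmul := h.adj_mul_eq hxy
  have hx := h.sq_eq x
  have hy := h.sq_eq y
  have hx0 := pow_pos (h.pos x) 2
  have hy0 := pow_pos (h.pos y) 2
  have hden : (0 : ℝ) < 2 * ν - 2 + Γ.degree x + Γ.degree y := by
    have : (0 : ℝ) ≤ ν := Nat.cast_nonneg _
    linarith
  have hlin : t * (2 * ν - 2 + Γ.degree x + Γ.degree y)
      = Γ.degree x * Γ.degree y - ((ν : ℝ) - 1) ^ 2 := by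
    have e : (α x * α y) ^ 2 = α x ^ 2 * α y ^ 2 := by ring
    rw [hmul, hx, hy] at e
    linear_combination e
  set q : ℚ := (Γ.degree x * Γ.degree y - ((ν : ℚ) - 1) ^ 2) /
    (2 * ν - 2 + Γ.degree x + Γ.degree y) with hq
  have htq : t = q := by
    rw [hq]
    push_cast
    rw [eq_div_iff hden.ne', hlin]
  have hroot : (Γ.adjMatrix ℝ).charpoly.IsRoot (-t) := by
    rw [← mem_spectrum_iff_isRoot_charpoly, h.spectrum_eq]
    simp
  have hintegral : IsIntegral ℤ (-q) := by
    refine ⟨(Γ.adjMatrix ℤ).charpoly, charpoly_monic _, ?_⟩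
    have hinj : Function.Injective (algebraMap ℚ ℝ) := (algebraMap ℚ ℝ).injective
    apply hinj
    rw [map_zero, Polynomial.hom_eval₂, ← hroot.eq_zero, htq, ← Polynomial.eval_map,
      RingHom.ext_int ((algebraMap ℚ ℝ).comp (algebraMap ℤ ℚ)) (Int.castRingHom ℝ),
      ← charpoly_map]
    congr 2
    · simp
    · ext i j
      simp [adjMatrix_apply]
  obtain ⟨z, hz⟩ := IsIntegrallyClosed.isIntegral_iff.1 hintegral
  refine ⟨-z, ?_⟩
  rw [htq]
  have : -q = (z : ℚ) := by rw [← hz]; simp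
  have : q = ((-z : ℤ) : ℚ) := by push_cast; linarith
  rw [this]
  simp

lemma exists_adj_degree_lt (h : Γ.ThreeEigenvalues s t α)
    (hΓ : ¬ ∃ k, Γ.IsRegularOfDegree k) :
    ∃ x y, Γ.Adj x y ∧ Γ.degree x = Γ.maxDegree ∧ Γ.degree y < Γ.maxDegree := by
  have := h.connected.nonempty
  by_contra! hcon
  obtain ⟨x, hx⟩ := Γ.exists_maximal_degree_vertex
  refine hΓ ⟨Γ.maxDegree, fun v => ?_⟩
  obtain ⟨p⟩ := h.connected.preconnected x v
  induction p with
  | nil => exact hx.symm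
  | cons hadj _ ih =>
    exact ih (le_antisymm (hcon _ _ hadj hx.symm) (Γ.degree_le_maxDegree _))

lemma lt_degree (h : Γ.ThreeEigenvalues s t α) {x y : V} (hxy : Γ.Adj x y)
    (hx : Γ.degree x = Γ.maxDegree) (hy : Γ.degree y < Γ.maxDegree) : s < Γ.degree x := by
  have hlt : s * α x < Γ.degree x * α x := by
    have h1 := congrFun h.mulVec_eq x
    rw [adjMatrix_mulVec_apply, Pi.smul_apply, smul_eq_mul] at h1
    rw [← h1, ← card_neighborFinset_eq_degree, ← nsmul_eq_mul, ← Finset.sum_const]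
    refine Finset.sum_lt_sum (fun v _ => ?_) ⟨y, by simpa using hxy, ?_⟩
    · refine (sq_le_sq₀ (h.pos v).le (h.pos x).le).1 ?_
      rw [h.sq_eq, h.sq_eq, hx]
      have : (Γ.degree v : ℝ) ≤ Γ.maxDegree := by exact_mod_cast Γ.degree_le_maxDegree v
      linarith
    · refine (sq_lt_sq₀ (h.pos y).le (h.pos x).le).1 ?_
      rw [h.sq_eq, h.sq_eq, hx]
      have : (Γ.degree y : ℝ) < Γ.maxDegree := by exact_mod_cast hy
      linarith
  exact lt_of_mul_lt_mul_right hlt (h.pos x).le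

lemma le_degree_sub_one (h : Γ.ThreeEigenvalues s t α) {m : ℕ}
    (hm : (m : ℝ) * (t + 1) = s + (Fintype.card V : ℝ) - 1) {x y : V} (hxy : Γ.Adj x y)
    (hx : Γ.degree x = Γ.maxDegree) (hy : Γ.degree y < Γ.maxDegree) :
    s ≤ Γ.degree x - 1 := by
  have hlt := h.lt_degree hxy hx hy
  obtain ⟨z, rfl⟩ := h.exists_int_eq hxy
  obtain rfl : s = ((m * (z + 1) - Fintype.card V + 1 : ℤ) : ℝ) := by
    push_cast
    linarith
  have : (m * (z + 1) - Fintype.card V + 1 : ℤ) ≤ Γ.degree x - 1 :=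
    Int.le_sub_one_of_lt (by exact_mod_cast hlt)
  exact_mod_cast this

lemma one_le_of_adj (h : Γ.ThreeEigenvalues s t α) {x y : V} (hxy : Γ.Adj x y) : 1 ≤ α y := by
  have hy := h.sq_eq y
  have hy0 := pow_pos (h.pos y) 2
  obtain ⟨z, rfl⟩ := h.exists_int_eq hxy
  rw [hy] at hy0
  have h1 : (1 : ℤ) ≤ Γ.degree y - z := by
    have : (0 : ℤ) < Γ.degree y - z := by exact_mod_cast hy0
    omega
  have h2 : (1 : ℝ) ≤ Γ.degree y - z := by exact_mod_cast h1
  rw [← hy] at h2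
  exact (one_le_sq_iff₀ (h.pos y).le).1 h2

lemma add_one_le_of_adj (h : Γ.ThreeEigenvalues s t α) {x y : V} (hxy : Γ.Adj x y)
    (hlt : Γ.degree y < Γ.degree x) : α y + 1 ≤ α x := by
  have hx := h.sq_eq x
  have hy := h.sq_eq y
  have hxy' := h.adj_mul_eq hxy
  have hlt' : 0 < α x - α y := by
    refine sub_pos.2 ((sq_lt_sq₀ (h.pos y).le (h.pos x).le).1 ?_)
    have : (Γ.degree y : ℝ) < Γ.degree x := by exact_mod_cast hlt
    linarith
  have hsq : (α x - α y) ^ 2 = Γ.degree x - t + (Γ.degree y - t)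
      - 2 * (Fintype.card (Γ.commonNeighbors x y) + t - 1) := by
    rw [← hx, ← hy, ← hxy']
    ring
  have h0 := pow_pos hlt' 2
  have h2 : 1 ≤ (α x - α y) ^ 2 := by
    obtain ⟨z, rfl⟩ := h.exists_int_eq hxy
    rw [hsq] at h0 ⊢
    have h1 : (0 : ℤ) < Γ.degree x - z + (Γ.degree y - z)
      - 2 * (Fintype.card (Γ.commonNeighbors x y) + z - 1) := by exact_mod_cast h0
    exact_mod_cast Int.add_one_le_of_lt h1
  linarith [(one_le_sq_iff₀ hlt'.le).1 h2]

lemma card_le_div (h : Γ.ThreeEigenvalues s t α) {m : ℕ}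
    (hm : (m : ℝ) * (t + 1) = s + (Fintype.card V : ℝ) - 1) {x y : V} (hxy : Γ.Adj x y)
    (hx : Γ.degree x = Γ.maxDegree) (hy : Γ.degree y < Γ.maxDegree) :
    (Fintype.card V : ℝ)
      ≤ ((t + 1) * (α x ^ 2 - α x + 3 * t) + 2 * α x ^ 2 + 2 * t - 2) / (t - 1) := by
  have ht := h.two_le
  have hle := h.le_degree_add_degree_sub hm hxy
  have hsx := h.lt_degree hxy hx hy
  have hy1 := h.one_le_of_adj hxy
  have hyx := h.add_one_le_of_adj hxy (hx ▸ hy)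
  have hprod : 0 ≤ (α y - 1) * (α x - (α y + 1)) :=
    mul_nonneg (sub_nonneg.2 hy1) (sub_nonneg.2 hyx)
  have hle' : (Fintype.card V : ℝ) - 2 * m ≤ α x ^ 2 - α x + 3 * t := by
    linarith [h.sq_eq x, h.sq_eq y, h.adj_mul_eq hxy]
  rw [le_div_iff₀ (by linarith)]
  have := mul_le_mul_of_nonneg_left hle' (show 0 ≤ t + 1 by linarith)
  linarith [h.sq_eq x]

lemma lt_sqrt_sub_sq (h : Γ.ThreeEigenvalues s t α) {m : ℕ}
    (hm : (m : ℝ) * (t + 1) = s + (Fintype.card V : ℝ) - 1) {x y : V} (hxy : Γ.Adj x y)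
    (hx : Γ.degree x = Γ.maxDegree) (hy : Γ.degree y < Γ.maxDegree) :
    (t - 1) * (t - 2) - 2 * α x ^ 2 < (√(2 * Fintype.card V) - (t + 1)) ^ 2 := by
  have ht := h.two_le
  have hsx := h.le_degree_sub_one hm hxy hx hy
  have hcard : 2 * (Fintype.card V : ℝ) ≤ (m + 2) * (m + 1) := by
    have h1 : (Fintype.card V : ℝ) ≤ ((m + 2).choose 2 : ℕ) := by
      exact_mod_cast h.card_le_choose hm
    rw [Nat.cast_choose_two] at h1
    push_cast at h1
    linarith
  have hsqrt : √(2 * Fintype.card V) < m + 3 / 2 := by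
    rw [Real.sqrt_lt' (by positivity)]
    linarith
  have hsq : √(2 * Fintype.card V) ^ 2 = 2 * Fintype.card V := Real.sq_sqrt (by positivity)
  have := mul_lt_mul_of_pos_left hsqrt (show 0 < 2 * (t + 1) by linarith)
  linarith [h.sq_eq x]

end ThreeEigenvalues

end SimpleGraph

end

/-- For a graph in H(s,t) with t ≥ 2, m the multiplicity of −t, and adjacent vertices
x ~ y: d_x + d_y − ν_{x,y} ≥ n − 2m; moreover if d_x = Δ(Γ) then, with α_x = √(d_x − t),
n ≤ ((t+1)(α_x² − α_x + 3t) + 2α_x² + 2t − 2)/(t−1) and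
(√(2n) − (t+1))² > (t−1)(t−2) − 2α_x². -/
theorem H_st_vertex_count_bounds
    {V : Type} [Fintype V] [DecidableEq V] (Γ : SimpleGraph V) [DecidableRel Γ.Adj]
    (s t : ℝ)
    (hconn : Γ.Connected)
    (hnonreg : ¬ ∃ k, Γ.IsRegularOfDegree k)
    (hs : 1 < s) (ht : -t < 1) (ht2 : 2 ≤ t)
    (hspec : spectrum ℝ (Γ.adjMatrix ℝ) = {s, 1, -t})
    (m : ℕ) (hm : (m : ℝ) * (t + 1) = s + (Fintype.card V : ℝ) - 1)
    (x y : V) (hxy : Γ.Adj x y) :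
    let n : ℝ := (Fintype.card V : ℝ)
    let ν : ℝ := (Fintype.card (Γ.commonNeighbors x y) : ℝ)
    let αx : ℝ := Real.sqrt ((Γ.degree x : ℝ) - t)
    (Γ.degree x : ℝ) + (Γ.degree y : ℝ) - ν ≥ n - 2 * m ∧
    (Γ.degree x = Γ.maxDegree →
      n ≤ ((t + 1) * (αx ^ 2 - αx + 3 * t) + 2 * αx ^ 2 + 2 * t - 2) / (t - 1) ∧
      (Real.sqrt (2 * n) - (t + 1)) ^ 2 > (t - 1) * (t - 2) - 2 * αx ^ 2) := by
  intro n ν αx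
  obtain ⟨α, hpos, hα, hmul⟩ := hconn.exists_vecMulVec_eq hs (by linarith) hspec ht
  have h : Γ.ThreeEigenvalues s t α := ⟨hconn, hs, ht2, hspec, hpos, hα, hmul⟩
  refine ⟨h.le_degree_add_degree_sub hm hxy, fun hx => ?_⟩
  obtain ⟨x', y', hxy', hx', hy'⟩ := h.exists_adj_degree_lt hnonreg
  have hαx : αx = α x' := by
    rw [← Real.sqrt_sq (hpos x').le, h.sq_eq, hx', ← hx]
  rw [hαx]
  exact ⟨h.card_le_div hm hxy' hx' hy', h.lt_sqrt_sub_sq hm hxy' hx' hy'⟩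
end

section
/- Let Γ be an n-vertex connected nonregular finite simple graph whose adjacency matrix has exactly three distinct eigenvalues s > 1 > −t, which is not a cone and not biregular, and let x be a vertex with d_x = Δ(Γ); write α_x := √(d_x − t). Then: (a) if α_x ≤ (t+4)/2 then t ≤ 15; (b) if α_x ≤ (t+18)/3 then t ≤ 19; (c) if α_x ≤ (t+3)/√3 then t ≤ 21; (d) if α_x ≤ (t+7)/2 then t ≤ 22; (e) if α_x ≤ (t+10)/2 then t ≤ 29. -/
namespace Matrix

open Polynomial in
theorem IsHermitian.mul_eq_zero_of_spectrum_eq {V : Type*} [Fintype V] [DecidableEq V]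
    {A : Matrix V V ℝ} (hA : A.IsHermitian) {a b c : ℝ} (hspec : spectrum ℝ A = {a, b, c}) :
    (A - a • 1) * ((A - b • 1) * (A - c • 1)) = 0 := by
  have hsa : IsSelfAdjoint A := hA
  have h1 := cfc_polynomial (R := ℝ) ((X - C a) * ((X - C b) * (X - C c))) A hsa
  have h2 : cfc (((X - C a) * ((X - C b) * (X - C c)) : ℝ[X])).eval A = 0 := by
    rw [← cfc_zero ℝ A]
    refine cfc_congr ?_
    intro r hr
    rw [hspec] at hr
    rcases hr with rfl | rfl | rfl <;> simp
  rw [h2] at h1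
  simpa [Algebra.algebraMap_eq_smul_one] using h1.symm

theorem IsHermitian.posSemidef_smul_one_sub_s14 {V : Type*} [Fintype V] [DecidableEq V]
    {A : Matrix V V ℝ} (hA : A.IsHermitian) {s : ℝ} (hspec : ∀ r ∈ spectrum ℝ A, r ≤ s) :
    (s • 1 - A).PosSemidef := by
  have hH : (s • (1 : Matrix V V ℝ) - A).IsHermitian := by
    apply Matrix.IsHermitian.sub _ hA
    simp [Matrix.IsHermitian]
  rw [hH.posSemidef_iff_eigenvalues_nonneg]
  intro i
  have := hH.eigenvalues_mem_spectrum_real i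
  generalize hH.eigenvalues i = e at this ⊢
  rw [← Algebra.algebraMap_eq_smul_one, ← spectrum.singleton_sub_eq] at this
  obtain ⟨a, ha, b, hb, h⟩ := this
  simp only [Set.mem_singleton_iff] at ha
  subst ha
  have := hspec b hb
  simp only [Pi.zero_apply] at h ⊢
  linarith

/-- The real version of the fact that an idempotent matrix has trace equal to its rank. -/
theorem trace_eq_rank_of_mul_self {V : Type*} [Fintype V] [DecidableEq V] {P : Matrix V V ℝ}
    (hP : P * P = P) : P.trace = P.rank := by
  have h : IsIdempotentElem (Matrix.toLin' P) := by
    rw [IsIdempotentElem, Module.End.mul_eq_comp, ← Matrix.toLin'_mul, hP]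
  rw [← Matrix.trace_toLin'_eq, (LinearMap.IsIdempotentElem.isProj_range _ h).trace, Matrix.rank,
    Matrix.toLin'_apply']

/-- The entrywise square of a matrix of rank `r` has rank at most `r (r + 1) / 2`. -/
theorem rank_hadamard_self_le_s14 {V : Type*} [Fintype V] [DecidableEq V] (B : Matrix V V ℝ) :
    (B.hadamard B).rank ≤ (B.rank + 1).choose 2 := by
  classical
  set W := Submodule.span ℝ (Set.range B.row) with hW
  have hr : B.rank = Module.finrank ℝ W := B.rank_eq_finrank_span_row
  let b := Module.finBasis ℝ W
  let g : Sym2 (Fin (Module.finrank ℝ W)) → V → ℝ :=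
    Sym2.lift ⟨fun k l => (b k : V → ℝ) * (b l : V → ℝ), fun k l => mul_comm _ _⟩
  have hle : Submodule.span ℝ (Set.range (B.hadamard B).row) ≤ Submodule.span ℝ (Set.range g) := by
    rw [Submodule.span_le]
    rintro _ ⟨v, rfl⟩
    have hv : B.row v ∈ W := Submodule.subset_span ⟨v, rfl⟩
    have h1 : B.row v = ∑ k, b.repr ⟨_, hv⟩ k • (b k : V → ℝ) := by
      have := congrArg W.subtype (b.sum_repr ⟨_, hv⟩)
      rw [map_sum] at this
      exact this.symm
    have h2 : (B.hadamard B).row v = B.row v * B.row v := by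
      ext w; simp [Matrix.hadamard, Matrix.row]
    rw [h2]
    nth_rewrite 1 [h1]
    nth_rewrite 2 [h1]
    rw [Finset.sum_mul_sum]
    refine Submodule.sum_mem _ fun k _ => Submodule.sum_mem _ fun l _ => ?_
    rw [smul_mul_smul_comm]
    exact Submodule.smul_mem _ _ (Submodule.subset_span ⟨s(k, l), rfl⟩)
  rw [Matrix.rank_eq_finrank_span_row, hr]
  refine (Submodule.finrank_mono hle).trans ((finrank_range_le_card g).trans ?_)
  have := Sym2.natCard (α := Fin (Module.finrank ℝ W))
  simp only [Nat.card_eq_fintype_card, Fintype.card_fin] at this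
  rw [this]

theorem rank_add_vecMulVec_le {V : Type*} [Fintype V] (P : Matrix V V ℝ)
    (u w : V → ℝ) : (P + vecMulVec u w).rank ≤ P.rank + 1 := by
  have h1 : (P + vecMulVec u w).rank ≤ P.rank + (vecMulVec u w).rank := by
    rw [Matrix.rank, Matrix.rank, Matrix.rank, Matrix.mulVecLin_add]
    exact (Submodule.finrank_mono (LinearMap.range_add_le _ _)).trans
      (Submodule.finrank_add_le_finrank_add_finrank _ _)
  have := Matrix.rank_vecMulVec_le u w
  omega

end Matrix

namespace SimpleGraph

variable {V : Type*} {G : SimpleGraph V}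

theorem Connected.induct (hG : G.Connected) {p : V → Prop}
    (h : ∀ u w, G.Adj u w → p u → p w) {i : V} (hi : p i) (j : V) : p j := by
  obtain ⟨q⟩ := hG.preconnected i j
  induction q with
  | nil => exact hi
  | cons hadj _ ih => exact ih (h _ _ hadj hi)

variable [Fintype V] [DecidableEq V] [DecidableRel G.Adj]

open Matrix

omit [DecidableEq V] in
theorem Connected.eigenvector_pos (hG : G.Connected) {s : ℝ} {v : V → ℝ}
    (hv : G.adjMatrix ℝ *ᵥ v = s • v) (hv0 : ∀ i, 0 ≤ v i) {k : V} (hk : v k ≠ 0) (i : V) :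
    0 < v i := by
  refine lt_of_le_of_ne (hv0 i) fun hi => hk ?_
  refine hG.induct (p := fun j => v j = 0) (fun u w hadj hu => ?_) hi.symm k
  have h := congrFun hv u
  simp only [adjMatrix_mulVec_apply, Pi.smul_apply, hu, smul_zero] at h
  rw [Finset.sum_eq_zero_iff_of_nonneg (fun i _ => hv0 i)] at h
  exact h w (by simpa using hadj)

theorem abs_eigenvector {s : ℝ} (hpsd : (s • 1 - G.adjMatrix ℝ).PosSemidef) {v : V → ℝ}
    (hv : G.adjMatrix ℝ *ᵥ v = s • v) : G.adjMatrix ℝ *ᵥ |v| = s • |v| := by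
  have h0 : (s • 1 - G.adjMatrix ℝ) *ᵥ |v| = 0 := by
    rw [← hpsd.dotProduct_mulVec_zero_iff]
    refine le_antisymm ?_ (hpsd.dotProduct_mulVec_nonneg _)
    have h1 : v ⬝ᵥ (s • 1 - G.adjMatrix ℝ) *ᵥ v = 0 := by
      simp [sub_mulVec, hv, smul_mulVec]
    rw [← h1]
    simp only [sub_mulVec, smul_mulVec, one_mulVec, dotProduct_sub, star_trivial]
    refine sub_le_sub (le_of_eq ?_) ?_
    · simp [dotProduct, mul_left_comm _ s]
    · simp only [dotProduct, adjMatrix_mulVec_apply, Finset.mul_sum]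
      refine Finset.sum_le_sum fun i _ => Finset.sum_le_sum fun j _ => ?_
      rw [Pi.abs_apply, Pi.abs_apply, ← abs_mul]
      exact le_abs_self _
  rw [sub_mulVec, smul_mulVec, one_mulVec, sub_eq_zero] at h0
  exact h0.symm

theorem Connected.eigenvector_eq_zero (hG : G.Connected) {s : ℝ}
    (hpsd : (s • 1 - G.adjMatrix ℝ).PosSemidef) {v : V → ℝ}
    (hv : G.adjMatrix ℝ *ᵥ v = s • v) {i : V} (hi : v i = 0) : v = 0 := by
  by_contra hne
  obtain ⟨k, hk⟩ := Function.ne_iff.mp hne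
  have := hG.eigenvector_pos (abs_eigenvector hpsd hv) (fun j => abs_nonneg (v j))
    (k := k) (by simpa using hk) i
  simp [hi] at this

theorem Connected.exists_pos_eigenvector (hG : G.Connected) {s : ℝ}
    (hpsd : (s • 1 - G.adjMatrix ℝ).PosSemidef) (hs : s ∈ spectrum ℝ (G.adjMatrix ℝ)) :
    ∃ u : V → ℝ, (∀ i, 0 < u i) ∧ G.adjMatrix ℝ *ᵥ u = s • u := by
  rw [← spectrum_toLin', ← Module.End.hasEigenvalue_iff_mem_spectrum] at hs
  obtain ⟨v, hv⟩ := hs.exists_hasEigenvector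
  have hv1 : G.adjMatrix ℝ *ᵥ v = s • v := by simpa using hv.apply_eq_smul
  obtain ⟨k, hk⟩ := Function.ne_iff.mp hv.2
  exact ⟨|v|, hG.eigenvector_pos (abs_eigenvector hpsd hv1) (fun j => abs_nonneg (v j))
    (k := k) (by simpa using hk), abs_eigenvector hpsd hv1⟩

/-- A connected graph with exactly three eigenvalues `s > 1 > -t` satisfies
`(A - 1) (A + t) = α αᵀ` for a positive eigenvector `α` of its largest eigenvalue. -/
theorem Connected.exists_vecMulVec (hG : G.Connected) {s t : ℝ} (hs : 1 < s) (ht : -t < 1)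
    (hspec : spectrum ℝ (G.adjMatrix ℝ) = {s, 1, -t}) :
    ∃ α : V → ℝ, (∀ i, 0 < α i) ∧ G.adjMatrix ℝ *ᵥ α = s • α ∧
      (G.adjMatrix ℝ - 1) * (G.adjMatrix ℝ + t • 1) = vecMulVec α α := by
  have hH : (G.adjMatrix ℝ).IsHermitian := by
    simp [IsHermitian, conjTranspose_eq_transpose_of_trivial]
  have hpsd : (s • 1 - G.adjMatrix ℝ).PosSemidef := by
    refine hH.posSemidef_smul_one_sub_s14 fun r hr => ?_
    rw [hspec] at hr
    rcases hr with rfl | rfl | rfl <;> linarith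
  obtain ⟨u, hu0, hu⟩ := hG.exists_pos_eigenvector hpsd (by rw [hspec]; simp)
  have hann := hH.mul_eq_zero_of_spectrum_eq hspec
  rw [one_smul, neg_smul, sub_neg_eq_add] at hann
  set M := (G.adjMatrix ℝ - 1) * (G.adjMatrix ℝ + t • 1) with hM
  have hcol (i v w) : M v w * u i = M i w * u v := by
    have h1 : G.adjMatrix ℝ *ᵥ (M.col w) = s • M.col w := by
      rw [sub_mul, smul_mul, one_mul, sub_eq_zero] at hann
      ext a
      simpa using congrFun (congrFun hann a) w
    have h2 : u i • M.col w - M i w • u = 0 := by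
      refine hG.eigenvector_eq_zero hpsd (i := i) ?_ (by simp [mul_comm])
      rw [mulVec_sub, mulVec_smul, mulVec_smul, h1, hu, smul_sub, smul_comm, smul_comm s (M i w)]
    have := congrFun h2 v
    simp only [Pi.sub_apply, Pi.smul_apply, col_apply, smul_eq_mul, Pi.zero_apply] at this
    linarith
  have hsymm (v w) : M v w = M w v := by
    have : Mᵀ = M := by
      rw [hM, transpose_mul, transpose_add, transpose_sub, transpose_adjMatrix, transpose_smul,
        transpose_one, add_mul, mul_sub, mul_sub, sub_mul, mul_add, mul_add]
      simp only [Matrix.smul_mul, Matrix.mul_smul, one_mul, mul_one]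
      abel
    exact congrFun (congrFun this w) v
  obtain ⟨i⟩ := hG.nonempty
  obtain ⟨c, hc⟩ : ∃ c, ∀ v w, M v w = c * (u v * u w) := by
    refine ⟨M i i / (u i * u i), fun v w => ?_⟩
    have := hcol i v w
    have h2 := hcol i w i
    rw [hsymm i w] at this
    have hne := (hu0 i).ne'
    field_simp
    linear_combination u i * this + u v * h2
  have hMu : M *ᵥ u = ((s - 1) * (s + t)) • u := by
    rw [hM, ← mulVec_mulVec, add_mulVec, hu, smul_mulVec, one_mulVec, ← add_smul, mulVec_smul,
      sub_mulVec, one_mulVec, hu]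
    module
  have hcpos : 0 < c := by
    have h := congrFun hMu i
    simp only [mulVec, dotProduct, hc, Pi.smul_apply, smul_eq_mul] at h
    have h3 : ∑ w, c * (u i * u w) * u w = c * u i * ∑ w, u w ^ 2 := by
      rw [Finset.mul_sum]; exact Finset.sum_congr rfl fun _ _ => by ring
    rw [h3] at h
    have h4 : 0 < c * u i * ∑ w, u w ^ 2 := by
      rw [h]
      exact mul_pos (mul_pos (by linarith) (by linarith)) (hu0 i)
    by_contra hneg
    push Not at hneg
    have : c * (u i * ∑ w, u w ^ 2) ≤ 0 := mul_nonpos_of_nonpos_of_nonneg hneg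
      (mul_nonneg (hu0 i).le (Finset.sum_nonneg fun _ _ => sq_nonneg _))
    nlinarith
  refine ⟨√c • u, fun j => mul_pos (Real.sqrt_pos.mpr hcpos) (hu0 j), ?_, ?_⟩
  · rw [mulVec_smul, hu, smul_comm]
  · ext v w
    rw [hc, vecMulVec_apply]
    simp only [Pi.smul_apply, smul_eq_mul]
    linear_combination (-(u v * u w)) * Real.mul_self_sqrt hcpos.le

end SimpleGraph

namespace SimpleGraph

variable {V : Type*} {G : SimpleGraph V} [Fintype V] [DecidableEq V] [DecidableRel G.Adj]

open Matrix

theorem adjMatrix_mul_self_apply_eq_card (v w : V) :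
    (G.adjMatrix ℝ * G.adjMatrix ℝ) v w = (G.neighborFinset v ∩ G.neighborFinset w).card := by
  rw [adjMatrix_mul_apply]
  simp only [adjMatrix_apply, Finset.sum_boole, ← Finset.filter_mem_eq_inter, mem_neighborFinset,
    G.adj_comm w]

section

variable {s t : ℝ} {α : V → ℝ}

theorem mul_eq_of_vecMulVec
    (hM : (G.adjMatrix ℝ - 1) * (G.adjMatrix ℝ + t • 1) = vecMulVec α α) (v w : V) :
    α v * α w = (G.neighborFinset v ∩ G.neighborFinset w).card + (t - 1) * G.adjMatrix ℝ v w
      - t * (1 : Matrix V V ℝ) v w := by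
  rw [← adjMatrix_mul_self_apply_eq_card, ← vecMulVec_apply, ← hM, sub_mul, mul_add, one_mul]
  simp only [Matrix.mul_smul, mul_one, Matrix.sub_apply, Matrix.add_apply, Matrix.smul_apply,
    smul_eq_mul]
  ring

theorem mul_self_eq_of_vecMulVec
    (hM : (G.adjMatrix ℝ - 1) * (G.adjMatrix ℝ + t • 1) = vecMulVec α α) (v : V) :
    α v * α v = G.degree v - t := by
  rw [mul_eq_of_vecMulVec hM]
  simp

theorem mul_eq_of_adj
    (hM : (G.adjMatrix ℝ - 1) * (G.adjMatrix ℝ + t • 1) = vecMulVec α α) {v w : V}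
    (h : G.Adj v w) :
    α v * α w = (G.neighborFinset v ∩ G.neighborFinset w).card + (t - 1) := by
  rw [mul_eq_of_vecMulVec hM]
  simp [h, h.ne]

theorem mul_eq_of_not_adj
    (hM : (G.adjMatrix ℝ - 1) * (G.adjMatrix ℝ + t • 1) = vecMulVec α α) {v w : V}
    (hne : v ≠ w) (h : ¬ G.Adj v w) :
    α v * α w = (G.neighborFinset v ∩ G.neighborFinset w).card := by
  rw [mul_eq_of_vecMulVec hM]
  simp [h, hne]

theorem Connected.dotProduct_self_eq (hG : G.Connected) (hα : ∀ i, 0 < α i)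
    (hA : G.adjMatrix ℝ *ᵥ α = s • α)
    (hM : (G.adjMatrix ℝ - 1) * (G.adjMatrix ℝ + t • 1) = vecMulVec α α) :
    α ⬝ᵥ α = (s - 1) * (s + t) := by
  obtain ⟨i⟩ := hG.nonempty
  have h := congrFun (congrArg (· *ᵥ α) hM) i
  simp only [← mulVec_mulVec, add_mulVec, hA, smul_mulVec, one_mulVec, ← add_smul, mulVec_smul,
    sub_mulVec] at h
  simp only [mulVec, dotProduct, vecMulVec_apply, Pi.smul_apply, Pi.sub_apply, smul_eq_mul,
    mul_assoc, ← Finset.mul_sum] at h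
  have := (hα i).ne'
  rw [dotProduct]
  apply mul_left_cancel₀ this
  linear_combination -h

/-- Multiplicity data of the smallest eigenvalue `-t`: the trace identity, the absolute bound, and
the bound on independent sets. -/
theorem Connected.exists_multiplicity (hG : G.Connected) (hs : 1 < s) (ht : 1 < t)
    (hspec : spectrum ℝ (G.adjMatrix ℝ) = {s, 1, -t}) (hα : ∀ i, 0 < α i)
    (hA : G.adjMatrix ℝ *ᵥ α = s • α)
    (hM : (G.adjMatrix ℝ - 1) * (G.adjMatrix ℝ + t • 1) = vecMulVec α α) :
    ∃ m : ℕ, (m : ℝ) * (t + 1) = Fintype.card V - 1 + s ∧ Fintype.card V ≤ (m + 2).choose 2 ∧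
      ∀ L : Finset V, (∀ v ∈ L, ∀ w ∈ L, ¬ G.Adj v w) → L.card ≤ m := by
  have hdot := hG.dotProduct_self_eq hα hA hM
  have hst : 0 < s + t := by linarith
  have ht1 : 0 < t + 1 := by linarith
  set A := G.adjMatrix ℝ with hAdef
  set N := vecMulVec α α with hN
  have hAN : A * N = s • N := by rw [hN, mul_vecMulVec, hA, smul_vecMulVec]
  have hNA : N * A = s • N := by
    have := congrArg Matrix.transpose hAN
    simpa [hN, hAdef, transpose_mul, transpose_vecMulVec] using this
  have hNN : N * N = ((s - 1) * (s + t)) • N := by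
    rw [hN, vecMulVec_mul_vecMulVec, hdot, vecMulVec_smul]
  have hAA : A * A = N - (t - 1) • A + t • 1 := by
    rw [← hM, sub_mul, mul_add, one_mul, Matrix.mul_smul, mul_one]
    module
  set Q := 1 - A + (s + t)⁻¹ • N with hQ
  have hQQ : Q * Q = (t + 1) • Q := by
    rw [hQ]
    simp only [mul_add, add_mul, mul_sub, sub_mul, mul_one, one_mul, Matrix.smul_mul,
      Matrix.mul_smul, hAN, hNA, hNN, hAA]
    match_scalars <;> field_simp <;> ring
  have hPP : ((t + 1)⁻¹ • Q) * ((t + 1)⁻¹ • Q) = (t + 1)⁻¹ • Q := by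
    rw [Matrix.smul_mul, Matrix.mul_smul, hQQ, smul_smul _ _ Q, inv_mul_cancel₀ ht1.ne', one_smul]
  have htr := Matrix.trace_eq_rank_of_mul_self hPP
  have hrankQ : ((t + 1)⁻¹ • Q).rank = Q.rank :=
    rank_smul_of_mem_nonZeroDivisors _ (mem_nonZeroDivisors_of_ne_zero (inv_ne_zero ht1.ne'))
  rw [hrankQ] at htr
  refine ⟨Q.rank, ?_, ?_, ?_⟩
  · rw [← htr, hQ, hN, hAdef]
    simp only [trace_smul, trace_add, trace_sub, trace_one, trace_adjMatrix, smul_eq_mul,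
      trace_vecMulVec, hdot]
    field_simp
    ring
  · have hB : (1 - A).rank ≤ Q.rank + 1 := by
      have : 1 - A = Q + vecMulVec (-(s + t)⁻¹ • α) α := by
        rw [hQ, smul_vecMulVec, ← hN]
        module
      rw [this]
      exact rank_add_vecMulVec_le _ _ _
    have hH : (1 - A).hadamard (1 - A) = 1 + A := by
      ext v w
      simp only [hadamard_apply, Matrix.sub_apply, Matrix.add_apply, one_apply, hAdef, adjMatrix_apply]
      by_cases hvw : v = w
      · subst hvw; simp
      · by_cases hadj : G.Adj v w <;> simp [hvw, hadj]
    have hunit : IsUnit (1 + A) := by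
      have h1 : (-1 : ℝ) ∉ spectrum ℝ A := by
        rw [hspec]
        simp only [Set.mem_insert_iff, Set.mem_singleton_iff, not_or]
        refine ⟨by linarith, by norm_num, by intro h; linarith⟩
      rw [spectrum.notMem_iff] at h1
      have h2 := h1.neg
      rwa [map_neg, map_one, neg_sub, sub_neg_eq_add, add_comm] at h2
    have h := Matrix.rank_hadamard_self_le_s14 (1 - A)
    rw [hH, rank_of_isUnit _ hunit] at h
    exact h.trans (Nat.choose_le_choose 2 (by omega))
  · intro L hL
    have hpd : (Q.submatrix (Subtype.val : L → V) (Subtype.val : L → V)).PosDef := by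
      have : Q.submatrix (Subtype.val : L → V) (Subtype.val : L → V) =
          1 + (s + t)⁻¹ • vecMulVec (fun v : L => α v) (star fun v : L => α v) := by
        ext v w
        have hadj := hL v v.2 w w.2
        by_cases hvw : v = w
        · subst hvw; simp [hQ, hN, hAdef, vecMulVec_apply]
        · have hvw' : (v : V) ≠ w := fun h => hvw (Subtype.ext h)
          simp [hQ, hN, hAdef, hadj, hvw, hvw', vecMulVec_apply]
      rw [this]
      exact PosDef.one.add_posSemidef
        ((posSemidef_vecMulVec_self_star _).smul (inv_nonneg.mpr hst.le))
    have h := rank_of_isUnit _ hpd.isUnit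
    have h2 := rank_submatrix_le Q (Subtype.val : L → V) (Subtype.val : L → V)
    rw [h] at h2
    simpa using h2

/-- The parameter `t` is an integer. -/
theorem exists_int_of_vecMulVec (ht : 1 < t)
    (hspec : spectrum ℝ (G.adjMatrix ℝ) = {s, 1, -t})
    (hM : (G.adjMatrix ℝ - 1) * (G.adjMatrix ℝ + t • 1) = vecMulVec α α) (hα : ∀ i, 0 < α i)
    {v w : V} (h : G.Adj v w) : ∃ k : ℤ, t = k := by
  have hint : IsIntegral ℤ t := by
    have hroot : (G.adjMatrix ℝ).charpoly.IsRoot (-t) := by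
      rw [← mem_spectrum_iff_isRoot_charpoly, hspec]
      simp
    have hmap : (G.adjMatrix ℝ) = (G.adjMatrix ℤ).map (Int.castRingHom ℝ) := by
      ext a b
      by_cases hab : G.Adj a b <;> simp [hab]
    rw [hmap, charpoly_map] at hroot
    have : IsIntegral ℤ (-t) := ⟨_, charpoly_monic (G.adjMatrix ℤ), by
      rw [← Polynomial.eval_map]; exact hroot⟩
    simpa using this.neg
  have h1 := mul_self_eq_of_vecMulVec hM v
  have h2 := mul_self_eq_of_vecMulVec hM w
  have h3 := mul_eq_of_adj hM h
  set c := (G.neighborFinset v ∩ G.neighborFinset w).card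
  have hv := mul_pos (hα v) (hα v)
  have hw := mul_pos (hα w) (hα w)
  have hc : (0 : ℝ) ≤ c := Nat.cast_nonneg c
  have hden : (G.degree v + G.degree w + 2 * c - 2 : ℝ) ≠ 0 := by
    have : (0 : ℝ) < G.degree v + G.degree w + 2 * c - 2 := by linarith
    exact this.ne'
  have hq : t = algebraMap ℚ ℝ
      ((G.degree v * G.degree w - (c - 1) ^ 2) / (G.degree v + G.degree w + 2 * c - 2)) := by
    simp only [eq_ratCast]
    push_cast
    rw [eq_div_iff hden]
    have h4 : (α v * α v) * (α w * α w) = (α v * α w) * (α v * α w) := by ring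
    rw [h1, h2, h3] at h4
    linear_combination -h4
  rw [hq, isIntegral_algebraMap_iff (algebraMap ℚ ℝ).injective,
    IsIntegrallyClosed.isIntegral_iff] at hint
  obtain ⟨k, hk⟩ := hint
  exact ⟨k, by rw [hq, ← hk]; simp⟩

end

end SimpleGraph

namespace SimpleGraph

variable {V : Type*} {G : SimpleGraph V} [Fintype V] [DecidableEq V] [DecidableRel G.Adj]

open Matrix

section

variable {s t : ℝ} {α : V → ℝ} {x : V}

theorem sum_univ_eq_add_sum_neighborFinset (x : V) (f : V → ℝ) :
    ∑ v, f v = f x + ∑ v ∈ G.neighborFinset x, f v + ∑ v with v ≠ x ∧ ¬ G.Adj x v, f v := by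
  rw [← Finset.add_sum_erase _ f (Finset.mem_univ x), add_assoc,
    ← Finset.sum_filter_add_sum_filter_not (Finset.univ.erase x) (G.Adj x)]
  congr 2
  · refine Finset.sum_congr ?_ fun _ _ => rfl
    ext v
    simp only [Finset.mem_filter, Finset.mem_erase, Finset.mem_univ, mem_neighborFinset]
    exact ⟨fun h => h.2, fun h => ⟨⟨h.ne', trivial⟩, h⟩⟩
  · refine Finset.sum_congr ?_ fun _ _ => rfl
    ext v
    simp

theorem card_eq_one_add_degree_add (x : V) :
    Fintype.card V = 1 + G.degree x + Finset.card {v | v ≠ x ∧ ¬ G.Adj x v} := by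
  have h := sum_univ_eq_add_sum_neighborFinset (G := G) x 1
  simp only [Pi.one_apply, Finset.sum_const, nsmul_eq_mul, mul_one, card_neighborFinset_eq_degree,
    Finset.card_univ] at h
  exact_mod_cast h

theorem le_of_degree_le (hα : ∀ i, 0 < α i)
    (hM : (G.adjMatrix ℝ - 1) * (G.adjMatrix ℝ + t • 1) = vecMulVec α α) {v w : V}
    (h : G.degree v ≤ G.degree w) : α v ≤ α w := by
  have hv := mul_self_eq_of_vecMulVec hM v
  have hw := mul_self_eq_of_vecMulVec hM w
  have : (G.degree v : ℝ) ≤ G.degree w := by exact_mod_cast h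
  exact (mul_self_le_mul_self_iff (hα v).le (hα w).le).mpr (by linarith)

theorem sum_nonneighbors_mul_le (hα : ∀ i, 0 < α i)
    (hM : (G.adjMatrix ℝ - 1) * (G.adjMatrix ℝ + t • 1) = vecMulVec α α)
    (hx : ∀ v, G.degree v ≤ G.degree x) :
    ∑ v with v ≠ x ∧ ¬ G.Adj x v, α x * α v ≤ G.degree x * (2 * t - 2) := by
  have h1 := sum_univ_eq_add_sum_neighborFinset (G := G) x (fun v => α x * α v)
  have h2 : ∑ v, α x * α v = ∑ y ∈ G.neighborFinset x, (G.degree y : ℝ)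
      + (t - 1) * G.degree x - t := by
    simp_rw [mul_eq_of_vecMulVec hM, ← adjMatrix_mul_self_apply_eq_card, adjMatrix_mul_apply,
      Finset.sum_sub_distrib, Finset.sum_add_distrib, ← Finset.mul_sum]
    rw [Finset.sum_comm]
    have h3 (y : V) : ∑ w, G.adjMatrix ℝ y w = G.degree y := by
      simpa [mulVec, dotProduct] using G.adjMatrix_mulVec_const_apply (α := ℝ) (a := 1) (v := y)
    simp only [h3, one_apply, mul_one, Finset.sum_ite_eq, Finset.mem_univ, if_true]
  have h4 : ∑ y ∈ G.neighborFinset x, ((G.degree y : ℝ) - α x * α y) ≤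
      ∑ y ∈ G.neighborFinset x, t := by
    refine Finset.sum_le_sum fun y _ => ?_
    have h5 := mul_self_eq_of_vecMulVec hM y
    have h6 := mul_le_mul_of_nonneg_right (le_of_degree_le hα hM (hx y)) (hα y).le
    linarith
  have h7 := mul_self_eq_of_vecMulVec hM x
  simp only [Finset.sum_sub_distrib, Finset.sum_const, nsmul_eq_mul,
    card_neighborFinset_eq_degree] at h4
  linarith

theorem Connected.lt_degree (hG : G.Connected) (hnonreg : ¬ ∃ k, G.IsRegularOfDegree k)
    (hα : ∀ i, 0 < α i) (hA : G.adjMatrix ℝ *ᵥ α = s • α)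
    (hM : (G.adjMatrix ℝ - 1) * (G.adjMatrix ℝ + t • 1) = vecMulVec α α)
    (hx : ∀ v, G.degree v ≤ G.degree x) : s < G.degree x := by
  by_contra! hs
  have hle (v : V) : α v ≤ α x := le_of_degree_le hα hM (hx v)
  have hdeg (v : V) (hv : α v = α x) : G.degree v = G.degree x := by
    have h1 := mul_self_eq_of_vecMulVec hM v
    have h2 := mul_self_eq_of_vecMulVec hM x
    rw [hv] at h1
    exact_mod_cast (by linarith : (G.degree v : ℝ) = G.degree x)
  refine hnonreg ⟨G.degree x, fun v => hdeg v ?_⟩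
  refine hG.induct (p := fun v => α v = α x) (fun u w hadj hu => ?_) rfl v
  have h := congrFun hA u
  simp only [adjMatrix_mulVec_apply, Pi.smul_apply, smul_eq_mul] at h
  have h1 : ∑ y ∈ G.neighborFinset u, (α x - α y) ≤ 0 := by
    rw [Finset.sum_sub_distrib, h, Finset.sum_const, nsmul_eq_mul, card_neighborFinset_eq_degree,
      hdeg u hu, hu]
    nlinarith [hα x]
  have h2 := Finset.single_le_sum (f := fun y => α x - α y)
    (fun y _ => sub_nonneg.mpr (hle y)) ((G.mem_neighborFinset u w).mpr hadj)
  exact le_antisymm (hle w) (by linarith)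

theorem sub_one_le_mul_of_adj
    (hM : (G.adjMatrix ℝ - 1) * (G.adjMatrix ℝ + t • 1) = vecMulVec α α) {v w : V}
    (h : G.Adj v w) : t - 1 ≤ α v * α w := by
  rw [mul_eq_of_adj hM h]
  exact le_add_of_nonneg_left (Nat.cast_nonneg _)

theorem sub_one_le_mul (ht : 0 ≤ t) (hα : ∀ i, 0 < α i)
    (hM : (G.adjMatrix ℝ - 1) * (G.adjMatrix ℝ + t • 1) = vecMulVec α α)
    (hx : ∀ v, G.degree v ≤ G.degree x) (v : V) : t - 1 ≤ α x * α v := by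
  have hv := mul_self_eq_of_vecMulVec hM v
  have hpos : 0 < G.degree v := by
    have := mul_pos (hα v) (hα v)
    exact_mod_cast (by linarith : (0 : ℝ) < G.degree v)
  obtain ⟨w, hw⟩ := (G.degree_pos_iff_exists_adj v).mp hpos
  refine (sub_one_le_mul_of_adj hM hw).trans ?_
  rw [mul_comm]
  exact mul_le_mul_of_nonneg_right (le_of_degree_le hα hM (hx w)) (hα v).le

theorem card_nonneighbors_le (ht : 1 < t) (hα : ∀ i, 0 < α i)
    (hM : (G.adjMatrix ℝ - 1) * (G.adjMatrix ℝ + t • 1) = vecMulVec α α)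
    (hx : ∀ v, G.degree v ≤ G.degree x) :
    Finset.card {v | v ≠ x ∧ ¬ G.Adj x v} ≤ 2 * G.degree x := by
  have h := sum_nonneighbors_mul_le hα hM hx
  have h2 := Finset.card_nsmul_le_sum {v | v ≠ x ∧ ¬ G.Adj x v} (fun v => α x * α v) (t - 1)
    (fun v _ => sub_one_le_mul (by linarith) hα hM hx v)
  rw [nsmul_eq_mul] at h2
  have h3 : (Finset.card {v | v ≠ x ∧ ¬ G.Adj x v} : ℝ) ≤ 2 * G.degree x := by
    refine le_of_mul_le_mul_right ?_ (by linarith : 0 < t - 1)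
    linarith
  exact_mod_cast h3

/-- If each non-neighbour `v` of `x` either has small `α v` or large `α x * α v`, then the
non-neighbours of the first kind are independent and those of the second kind are few. -/
theorem card_nonneighbors_le_add (hα : ∀ i, 0 < α i)
    (hM : (G.adjMatrix ℝ - 1) * (G.adjMatrix ℝ + t • 1) = vecMulVec α α)
    (hx : ∀ v, G.degree v ≤ G.degree x) (hd : 0 < G.degree x) {m : ℕ}
    (hm : ∀ L : Finset V, (∀ v ∈ L, ∀ w ∈ L, ¬ G.Adj v w) → L.card ≤ m) {c : ℝ}
    (hc : ∀ v, v ≠ x → ¬ G.Adj x v → t - 1 ≤ α v * α v → c * G.degree x ≤ α x * α v) :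
    (Finset.card {v | v ≠ x ∧ ¬ G.Adj x v} - m) * c ≤ 2 * t - 2 ∨ c ≤ 0 := by
  rw [or_iff_not_imp_right, not_le]
  intro hc0
  have h := sum_nonneighbors_mul_le hα hM hx
  set U : Finset V := {v | v ≠ x ∧ ¬ G.Adj x v} with hU
  have hlow : Finset.card {v ∈ U | ¬ t - 1 ≤ α v * α v} ≤ m := by
    refine hm _ fun v hv w hw hadj => ?_
    have h1 := (Finset.mem_filter.mp hv).2
    have h2 := (Finset.mem_filter.mp hw).2
    have h3 := sub_one_le_mul_of_adj hM hadj
    nlinarith [sq_nonneg (α v - α w)]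
  have hhigh : Finset.card {v ∈ U | t - 1 ≤ α v * α v} * (c * G.degree x) ≤
      G.degree x * (2 * t - 2) := by
    rw [← nsmul_eq_mul]
    refine (Finset.card_nsmul_le_sum _ (fun v => α x * α v) _ fun v hv => ?_).trans
      ((Finset.sum_le_sum_of_subset_of_nonneg (Finset.filter_subset _ U) fun v _ _ =>
        (mul_pos (hα x) (hα v)).le).trans h)
    simp only [hU, Finset.mem_filter] at hv
    exact hc v hv.1.2.1 hv.1.2.2 hv.2
  have hcard := Finset.card_filter_add_card_filter_not (s := U) (fun v => t - 1 ≤ α v * α v)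
  have hdpos : (0 : ℝ) < G.degree x := by exact_mod_cast hd
  have h1 : (Finset.card {v ∈ U | t - 1 ≤ α v * α v} : ℝ) * c ≤ 2 * t - 2 := by
    refine le_of_mul_le_mul_right ?_ hdpos
    linarith
  have h2 : (U.card : ℝ) - m ≤ Finset.card {v ∈ U | t - 1 ≤ α v * α v} := by
    rw [sub_le_iff_le_add]
    exact_mod_cast (by omega : U.card ≤ Finset.card {v ∈ U | t - 1 ≤ α v * α v} + m)
  exact (mul_le_mul_of_nonneg_right h2 hc0.le).trans h1

end

end SimpleGraph

theorem mul_sub_add_neg_of_convex {D c a b q : ℝ} (haq : a ≤ q) (hqb : q < b)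
    (ha : a * a - D * a + c < 0) (hb : b * b - D * b + c < 0) : q * q - D * q + c < 0 := by
  by_contra! hq
  have h : (b - a) * (q * q - D * q + c) =
      (b - q) * (a * a - D * a + c) + (q - a) * (b * b - D * b + c)
        - (b - a) * (q - a) * (b - q) := by ring
  have h1 := mul_nonneg (by linarith : 0 ≤ b - a) hq
  have h2 := mul_pos (sub_pos.mpr hqb) (neg_pos.mpr ha)
  have h3 := mul_nonneg (sub_nonneg.mpr haq) (neg_pos.mpr hb).le
  have h4 := mul_nonneg (mul_nonneg (by linarith : 0 ≤ b - a) (sub_nonneg.mpr haq))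
    (sub_pos.mpr hqb).le
  linarith

theorem le_mul_of_mul_le_add_mul_self {a p t b : ℝ} (ha : 0 < a) (hp : 0 < p) (ht : 16 ≤ t)
    (hD : 5 * t ≤ a * a) (hpt : t - 1 ≤ p * p) (hap : a * p ≤ t + p * p)
    (hb : b * b - a * a * b + a * a * t < 0) : b ≤ a * p := by
  by_contra! hlt
  have h1 : 2 * t - 1 ≤ a * p := by
    refine le_of_sq_le_sq ?_ (mul_pos ha hp).le
    have := mul_le_mul hD hpt (by linarith) (by nlinarith)
    nlinarith
  have h2 : (2 * t - 1) * (2 * t - 1) - a * a * (2 * t - 1) + a * a * t < 0 := by nlinarith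
  have h3 := mul_sub_add_neg_of_convex h1 hlt h2 hb
  have h4 : 0 ≤ a * a * (t + p * p - a * p) := mul_nonneg (by nlinarith) (by linarith)
  nlinarith

theorem mul_sub_one_le_two_mul_of_bounds {t d s m n u : ℤ} (ht : 16 ≤ t) (hm : 0 ≤ m)
    (hs : s < d) (htr : m * (t + 1) = n - 1 + s) (habs : 2 * n ≤ (m + 2) * (m + 1))
    (hn : n = 1 + d + u) (hu0 : 0 ≤ u) (hu1 : u ≤ 2 * d)
    (hu2 : 5 * t ≤ d - t → u ≤ m + 4 * t) (hu3 : 6 * t ≤ d - t → u ≤ m + 3 * t) :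
    t * (t - 1) ≤ 2 * d := by
  by_contra! hd
  have hq : m * (2 * t - 1 - m) ≤ 2 * s := by nlinarith
  have hmt : t - 1 ≤ m := by
    by_contra! hlt
    nlinarith [mul_nonneg hm (by linarith : 0 ≤ t - 2 - m)]
  have hle (hm1 : m ≤ t + 1) : False := by
    have h := mul_nonneg (sub_nonneg.mpr hmt) (sub_nonneg.mpr hm1)
    have h1 : (t + 1) * (t - 2) ≤ m * (2 * t - 1 - m) := by
      rcases (by omega : m = t - 1 ∨ m = t ∨ m = t + 1) with rfl | rfl | rfl <;> nlinarith
    nlinarith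
  by_cases h6 : 6 * t ≤ d - t
  · have := hu3 h6
    refine hle ?_
    by_contra! hlt
    nlinarith
  by_cases h5 : 5 * t ≤ d - t
  · have := hu2 h5
    refine hle ?_
    by_contra! hlt
    nlinarith
  · push Not at h5
    have hm24 : m ≤ 23 := by
      by_contra! hlt
      nlinarith
    have ht24 : t ≤ 24 := by linarith
    interval_cases t <;> interval_cases m <;> omega

namespace SimpleGraph

variable {V : Type*} {G : SimpleGraph V} [Fintype V] [DecidableEq V] [DecidableRel G.Adj]

open Matrix

/-- A connected nonregular graph whose distinct eigenvalues are `s > 1 > -t`, with `t > 15`, has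
maximum degree at least `t (t - 1) / 2`. -/
theorem Connected.mul_sub_one_le_two_mul_maxDegree (hG : G.Connected)
    (hnonreg : ¬ ∃ k, G.IsRegularOfDegree k) {s t : ℝ} (hs : 1 < s) (ht : 15 < t)
    (hspec : spectrum ℝ (G.adjMatrix ℝ) = {s, 1, -t}) {x : V} (hx : G.degree x = G.maxDegree) :
    0 < G.degree x - t ∧ 16 ≤ t ∧ t * (t - 1) ≤ 2 * G.degree x ∧ ∃ k : ℤ, t = k := by
  obtain ⟨α, hα, hA, hM⟩ := hG.exists_vecMulVec hs (by linarith) hspec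
  have hx' (v : V) : G.degree v ≤ G.degree x := hx ▸ G.degree_le_maxDegree v
  have hxx := mul_self_eq_of_vecMulVec hM x
  have hxpos := mul_pos (hα x) (hα x)
  have hdpos : 0 < G.degree x := by
    exact_mod_cast (by linarith : (0 : ℝ) < G.degree x)
  obtain ⟨w, hw⟩ := (G.degree_pos_iff_exists_adj x).mp hdpos
  obtain ⟨k, rfl⟩ := exists_int_of_vecMulVec (by linarith) hspec hM hα hw
  have hk : 16 ≤ k := by
    have : (15 : ℤ) < k := by exact_mod_cast ht
    omega
  have hkR : (16 : ℝ) ≤ k := by exact_mod_cast hk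
  refine ⟨by linarith, hkR, ?_, k, rfl⟩
  obtain ⟨m, htr, habs, hind⟩ := hG.exists_multiplicity hs (by linarith) hspec hα hA hM
  have hlt := hG.lt_degree hnonreg hα hA hM hx'
  have hn := card_eq_one_add_degree_add (G := G) x
  have hu1 := card_nonneighbors_le (by linarith) hα hM hx'
  have hsplit {c : ℝ} (h5 : 5 * (k : ℝ) ≤ G.degree x - k)
      (hc : (c * G.degree x) * (c * G.degree x) - (G.degree x - k) * (c * G.degree x)
        + (G.degree x - k) * k < 0) := by
    refine card_nonneighbors_le_add (c := c) hα hM hx' hdpos hind fun v hv hadj hvk => ?_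
    refine le_mul_of_mul_le_add_mul_self (hα x) (hα v) hkR (by linarith) hvk ?_ (by rwa [hxx])
    have h1 := mul_self_eq_of_vecMulVec hM v
    have h2 : (Finset.card (G.neighborFinset x ∩ G.neighborFinset v) : ℝ) ≤ G.degree v := by
      rw [← card_neighborFinset_eq_degree]
      exact_mod_cast Finset.card_le_card Finset.inter_subset_right
    rw [mul_eq_of_not_adj hM (Ne.symm hv) hadj]
    linarith
  set u := Finset.card {v | v ≠ x ∧ ¬ G.Adj x v}
  obtain ⟨S, rfl⟩ : ∃ S : ℤ, s = S :=
    ⟨m * (k + 1) - Fintype.card V + 1, by push_cast; linarith⟩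
  have habs' : 2 * Fintype.card V ≤ (m + 2) * (m + 1) := by
    have := Nat.triangle_succ (m + 1)
    rw [Nat.choose_two_right] at habs
    have h2 := Nat.div_mul_le_self ((m + 2) * (m + 2 - 1)) 2
    simp only [Nat.add_succ_sub_one] at h2 habs
    omega
  have key : k * (k - 1) ≤ 2 * (G.degree x : ℤ) := by
    refine mul_sub_one_le_two_mul_of_bounds (m := m) (n := Fintype.card V) (u := u) hk
      (by positivity) (by exact_mod_cast hlt) (by exact_mod_cast htr) (by exact_mod_cast habs')
      (by exact_mod_cast hn) (by positivity) (by exact_mod_cast hu1) (fun h5 => ?_) fun h6 => ?_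
    · have h5' : 5 * (k : ℝ) ≤ G.degree x - k := by exact_mod_cast h5
      rcases hsplit (c := 1 / 2) h5' (by nlinarith) with h | h
      · have : (u : ℝ) ≤ m + 4 * k := by linarith
        exact_mod_cast this
      · norm_num at h
    · have h6' : 6 * (k : ℝ) ≤ G.degree x - k := by exact_mod_cast h6
      rcases hsplit (c := 2 / 3) (by linarith) (by nlinarith) with h | h
      · have : (u : ℝ) ≤ m + 3 * k := by linarith
        exact_mod_cast this
      · norm_num at h
  exact_mod_cast key

end SimpleGraph

/-- For a graph in H′(s,t) and a vertex x of maximum degree, with α_x = √(d_x − t):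
(a) α_x ≤ (t+4)/2 → t ≤ 15; (b) α_x ≤ (t+18)/3 → t ≤ 19; (c) α_x ≤ (t+3)/√3 → t ≤ 21;
(d) α_x ≤ (t+7)/2 → t ≤ 22; (e) α_x ≤ (t+10)/2 → t ≤ 29. -/
theorem H'_st_t_bounds_from_alpha
    {V : Type} [Fintype V] [DecidableEq V] (Γ : SimpleGraph V) [DecidableRel Γ.Adj]
    (s t : ℝ)
    (hconn : Γ.Connected)
    (hnonreg : ¬ ∃ k, Γ.IsRegularOfDegree k)
    (hs : 1 < s) (ht : -t < 1)
    (hspec : spectrum ℝ (Γ.adjMatrix ℝ) = {s, 1, -t})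
    (hnotcone : ¬ ∃ v : V, Γ.degree v = Fintype.card V - 1)
    (hnotbireg : ((Finset.univ : Finset V).image (fun v => Γ.degree v)).card ≠ 2)
    (x : V) (hx : Γ.degree x = Γ.maxDegree) :
    let αx : ℝ := Real.sqrt ((Γ.degree x : ℝ) - t)
    (αx ≤ (t + 4) / 2 → t ≤ 15) ∧
    (αx ≤ (t + 18) / 3 → t ≤ 19) ∧
    (αx ≤ (t + 3) / Real.sqrt 3 → t ≤ 21) ∧
    (αx ≤ (t + 7) / 2 → t ≤ 22) ∧
    (αx ≤ (t + 10) / 2 → t ≤ 29) := by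
  intro αx
  have hmain (h15 : 15 < t) := hconn.mul_sub_one_le_two_mul_maxDegree hnonreg hs h15 hspec hx
  have hsq (h15 : 15 < t) {b : ℝ} (hb : αx ≤ b) : t * (t - 3) ≤ 2 * (b * b) := by
    obtain ⟨h0, -, h2, -⟩ := hmain h15
    have h3 : αx * αx = Γ.degree x - t := Real.mul_self_sqrt h0.le
    have h4 := mul_self_le_mul_self (Real.sqrt_nonneg _ : 0 ≤ αx) hb
    linarith
  have hint {a : ℤ} (h15 : 15 < t) (h : (a : ℝ) < t) : (a : ℝ) + 1 ≤ t := by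
    obtain ⟨-, -, -, k, rfl⟩ := hmain h15
    exact_mod_cast h
  refine ⟨fun h => ?_, fun h => ?_, fun h => ?_, fun h => ?_, fun h => ?_⟩ <;> by_contra! ht'
  · have h1 := hsq ht' h
    have h2 := (hmain ht').2.1
    nlinarith
  · have h1 := hsq (by linarith) h
    have h2 := hint (a := 19) (by linarith) (by exact_mod_cast ht')
    norm_num at h2
    nlinarith
  · have h1 := hsq (by linarith) h
    have h2 := hint (a := 21) (by linarith) (by exact_mod_cast ht')
    norm_num at h2
    rw [div_mul_div_comm, Real.mul_self_sqrt (by norm_num)] at h1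
    nlinarith
  · have h1 := hsq (by linarith) h
    have h2 := hint (a := 22) (by linarith) (by exact_mod_cast ht')
    norm_num at h2
    nlinarith
  · have h1 := hsq (by linarith) h
    have h2 := hint (a := 29) (by linarith) (by exact_mod_cast ht')
    norm_num at h2
    nlinarith
end
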